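/- Let S×T be the product continuous bundle RDS on H and μ ∈ P_P(H). For any two finite measurable partitions R, Q of H: H_μ(R | D_H) ≤ H_μ(Q | D_H) + ∫ log N(R | Q)(ω) dP(ω). -/

import Mathlib

open MeasureTheory Set Filter Topology
open scoped ENNReal

namespace RelTail

variable {Ω W : Type*}

/-- The fiber over `ω` of a subset of a product space. -/
def fib (E : Set (Ω × W)) (ω : Ω) : Set W := {x | (ω, x) ∈ E}

/-- Minimal cardinality of a subfamily of the cover `R` whose fibers at `ω` cover the
fiber of `S` at `ω` (with the convention that the empty set needs one element). -/
noncomputable def coverNum (S : Set (Ω × W)) (R : Set (Set (Ω × W))) (ω : Ω) : ℕ :=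
  max 1 (sInf {n : ℕ | ∃ F : Finset (Set (Ω × W)), ↑F ⊆ R ∧ F.card = n ∧
    fib S ω ⊆ ⋃ u ∈ F, fib u ω})

/-- `N(R | Q)(ω) = max_{q ∈ Q} N(q, R)(ω)`. -/
noncomputable def relCoverNum (R Q : Set (Set (Ω × W))) (ω : Ω) : ℕ :=
  ⨆ q ∈ Q, coverNum q R ω

section Meas
variable [MeasurableSpace Ω] [MeasurableSpace W]

/-- A (finite or countable) random cover of `E`. -/
def IsRandomCover (E : Set (Ω × W)) (Q : Set (Set (Ω × W))) : Prop :=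
  Q.Countable ∧ (∀ q ∈ Q, MeasurableSet q) ∧ (∀ q ∈ Q, q ⊆ E) ∧
    ∀ ω, fib E ω ⊆ ⋃ q ∈ Q, fib q ω

/-- An open random cover: a random cover whose fibers are (a.e.) open in the fibers of `E`. -/
def IsOpenRandomCover [TopologicalSpace W] (P : Measure Ω) (E : Set (Ω × W))
    (Q : Set (Set (Ω × W))) : Prop :=
  IsRandomCover E Q ∧
    ∀ q ∈ Q, ∀ᵐ ω ∂P, ∃ U : Set W, IsOpen U ∧ fib q ω = U ∩ fib E ω

end Meas

/-- The join `⋁_{i<n} (Γ^i)^{-1} Q` of a cover (or partition). -/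
def iterJoin {Z : Type*} (Γ : Z → Z) (Q : Set (Set Z)) (n : ℕ) : Set (Set Z) :=
  {s | ∃ f : ℕ → Set Z, (∀ i, f i ∈ Q) ∧ s = ⋂ i ∈ Finset.range n, (Γ^[i]) ⁻¹' (f i)}

/-- `log N(R^{(n)} | Q^{(n)})(ω)`. -/
noncomputable def iterCoverLog (Θ : Ω × W → Ω × W) (R Q : Set (Set (Ω × W))) (n : ℕ)
    (ω : Ω) : ℝ :=
  Real.log (relCoverNum (iterJoin Θ R n) (iterJoin Θ Q n) ω)

/-- The relative tail entropy `h_Θ(R|Q)` of an open random cover `R` w.r.t. a random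
cover `Q`, as a limit (limsup) of `(1/n) ∫ log N(R^{(n)}|Q^{(n)}) dP`. -/
noncomputable def relCoverEnt [MeasurableSpace Ω] (P : Measure Ω) (Θ : Ω × W → Ω × W)
    (R Q : Set (Set (Ω × W))) : ℝ≥0∞ :=
  Filter.atTop.limsup fun n : ℕ => ENNReal.ofReal ((∫ ω, iterCoverLog Θ R Q n ω ∂P) / n)

/-- `h(Θ|Q)`: supremum over all open random covers `R` of `h_Θ(R|Q)`. -/
noncomputable def condTailEnt [MeasurableSpace Ω] [MeasurableSpace W] [TopologicalSpace W]
    (P : Measure Ω) (E : Set (Ω × W)) (Θ : Ω × W → Ω × W) (Q : Set (Set (Ω × W))) : ℝ≥0∞ :=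
  ⨆ R ∈ {R | IsOpenRandomCover P E R}, relCoverEnt P Θ R Q

/-- The relative tail entropy `h*(Θ)`: infimum over all random covers `Q` of `h(Θ|Q)`. -/
noncomputable def tailEnt [MeasurableSpace Ω] [MeasurableSpace W] [TopologicalSpace W]
    (P : Measure Ω) (E : Set (Ω × W)) (Θ : Ω × W → Ω × W) : ℝ≥0∞ :=
  ⨅ Q ∈ {Q | IsRandomCover E Q}, condTailEnt P E Θ Q

/-- The skew product transformation of a bundle RDS. -/
def skew (ϑ : Ω → Ω) (T : Ω → W → W) : Ω × W → Ω × W := fun p => (ϑ p.1, T p.1 p.2)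

/-- A continuous bundle random dynamical system over `(Ω, P, ϑ)` on `E`. -/
structure IsBundleRDS [MeasurableSpace Ω] [MeasurableSpace W] [TopologicalSpace W]
    (P : Measure Ω) (ϑ : Ω → Ω) (E : Set (Ω × W)) (T : Ω → W → W) : Prop where
  measurePreserving : MeasurePreserving ϑ P P
  measurable : Measurable fun p : Ω × W => T p.1 p.2
  mapsTo : ∀ ω, MapsTo (T ω) (fib E ω) (fib E (ϑ ω))
  continuousOn : ∀ᵐ ω ∂P, ContinuousOn (T ω) (fib E ω)

/-- A finite or countable measurable partition of a set `E`. -/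
def IsCountablePartition {Z : Type*} [MeasurableSpace Z] (E : Set Z) (R : Set (Set Z)) : Prop :=
  R.Countable ∧ (∀ s ∈ R, MeasurableSet s) ∧ (∀ s ∈ R, s ⊆ E) ∧
    R.PairwiseDisjoint id ∧ ⋃₀ R = E

/-- The conditional entropy `H_μ(R | m)` of a countable partition `R` given a
sub-σ-algebra `m`, via conditional expectations. -/
noncomputable def partCondEntropy {Z : Type*} (m : MeasurableSpace Z) [MeasurableSpace Z]
    (μ : Measure Z) (R : Set (Set Z)) : ℝ≥0∞ :=
  ∑' r : R, ENNReal.ofReal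
    (∫ z, Real.negMulLog ((μ[(r : Set Z).indicator (fun _ => (1 : ℝ)) | m]) z) ∂μ)

/-- The relative entropy `h_μ(R | m)` of the transformation `Γ` with respect to a
partition `R`, given the sub-σ-algebra `m`. -/
noncomputable def relEntPart {Z : Type*} (m : MeasurableSpace Z) [MeasurableSpace Z]
    (μ : Measure Z) (Γ : Z → Z) (R : Set (Set Z)) : ℝ≥0∞ :=
  Filter.atTop.limsup fun n : ℕ => partCondEntropy m μ (iterJoin Γ R n) / (n : ℝ≥0∞)

/-- The relative entropy `h_μ(Γ | m)` given the sub-σ-algebra `m`: supremum over all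
countable measurable partitions of `E` of finite conditional entropy. -/
noncomputable def relEnt {Z : Type*} (m : MeasurableSpace Z) [MeasurableSpace Z]
    (μ : Measure Z) (Γ : Z → Z) (E : Set Z) : ℝ≥0∞ :=
  ⨆ R ∈ {R | IsCountablePartition E R ∧ partCondEntropy m μ R ≠ ∞}, relEntPart m μ Γ R

/-- The fiberwise boundary `{(ω,x) : x ∈ ∂(R(ω))}` of a subset of a product space. -/
def fibFrontier [TopologicalSpace W] (R : Set (Ω × W)) : Set (Ω × W) :=
  {p | p.2 ∈ frontier (fib R p.1)}

/-- The sub-σ-algebra of `Ω × W₁ × W₂` generated by the first two coordinates,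
i.e. the σ-algebra `{(A × W₂) ∩ ⬝ : A ∈ F × B}`. -/
def firstPairSigma (Ω W₁ W₂ : Type*) [MeasurableSpace Ω] [MeasurableSpace W₁] :
    MeasurableSpace (Ω × W₁ × W₂) :=
  MeasurableSpace.comap (fun p : Ω × W₁ × W₂ => (p.1, p.2.1)) inferInstance

/-- The defect of upper semi-continuity of `f` at `m` relative to the set `S`. -/
noncomputable def uscDefect {M : Type*} [TopologicalSpace M] (f : M → ℝ≥0∞) (S : Set M)
    (m : M) : ℝ≥0∞ :=
  if f m ≠ ∞ then Filter.limsup f (𝓝[S] m) - f m else ∞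

/-- The factor (extension) transformation `(ω, y) ↦ (ω, π_ω y)`. -/
def factorMap {Y X : Type*} (πf : Ω → Y → X) : Ω × Y → Ω × X :=
  fun p => (p.1, πf p.1 p.2)

/-- `T` on `E` is a factor of `S` on `G` via the family `π_ω`. -/
structure IsFactor {Ω X Y : Type*} [MeasurableSpace Ω] [MeasurableSpace X] [MeasurableSpace Y]
    [TopologicalSpace X] [TopologicalSpace Y] (ϑ : Ω → Ω) (E : Set (Ω × X)) (G : Set (Ω × Y))
    (T : Ω → X → X) (S : Ω → Y → Y) (πf : Ω → Y → X) : Prop where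
  measurable : Measurable fun p : Ω × Y => πf p.1 p.2
  mapsTo : ∀ ω, MapsTo (πf ω) (fib G ω) (fib E ω)
  surjOn : ∀ ω, SurjOn (πf ω) (fib G ω) (fib E ω)
  continuousOn : ∀ ω, ContinuousOn (πf ω) (fib G ω)
  semiconj : ∀ ω, ∀ y ∈ fib G ω, πf (ϑ ω) (S ω y) = T ω (πf ω y)

lemma exists_cyl_subset (k : ℕ → ℕ) (V : Set (ℕ → ℕ)) (hV : IsOpen V)
    (hK : {x : ℕ → ℕ | ∀ i, x i ≤ k i} ⊆ V) :
    ∃ n, {x : ℕ → ℕ | ∀ i < n, x i ≤ k i} ⊆ V := by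
  by_contra! h
  have h' : ∀ n, ∃ x : ℕ → ℕ, (∀ i < n, x i ≤ k i) ∧ x ∉ V := by
    intro n
    obtain ⟨x, hx, hxV⟩ := Set.not_subset.1 (h n)
    exact ⟨x, hx, hxV⟩
  choose x hx hxV using h'
  have hc : IsCompact {x : ℕ → ℕ | ∀ i, x i ≤ k i} := by
    have : {x : ℕ → ℕ | ∀ i, x i ≤ k i} = Set.univ.pi (fun i => Set.Iic (k i)) := by
      ext x; simp [Pi.le_def]
    rw [this]
    exact isCompact_univ_pi fun i => (Set.finite_Iic (k i)).isCompact
  obtain ⟨y, hy, φ, hφ, hlim⟩ := hc.tendsto_subseq (x := fun n i => min (x n i) (k i))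
    (fun n i => min_le_right _ _)
  have hlim' : Tendsto (fun n => x (φ n)) atTop (𝓝 y) := by
    rw [tendsto_pi_nhds] at hlim ⊢
    intro i
    refine (hlim i).congr' ?_
    filter_upwards [eventually_gt_atTop i] with n hn
    have : i < φ n := lt_of_lt_of_le hn hφ.le_apply
    simp [hx (φ n) i this]
  have := hlim'.eventually (hV.mem_nhds (hK hy))
  obtain ⟨n, hn⟩ := this.exists
  exact hxV _ hn

lemma analytic_inner {α : Type*} [TopologicalSpace α] [PolishSpace α] [MeasurableSpace α]
    [BorelSpace α] (μ : Measure α) [IsFiniteMeasure μ] (f : (ℕ → ℕ) → α) (hf : Continuous f)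
    (c : ℝ≥0∞) (hc : c < μ (range f)) : ∃ K ⊆ range f, IsCompact K ∧ c ≤ μ K := by
  have step : ∀ (D : {D : Set (ℕ → ℕ) // c < μ (f '' D)}) (n : ℕ),
      ∃ k, c < μ (f '' (D.1 ∩ {x | x n ≤ k})) := by
    rintro ⟨D, hD⟩ n
    have hU : f '' D = ⋃ k : ℕ, f '' (D ∩ {x | x n ≤ k}) := by
      rw [← image_iUnion, ← inter_iUnion]
      congr 1
      symm
      rw [inter_eq_left]
      intro x _
      exact mem_iUnion.2 ⟨x n, le_refl (x n)⟩
    have hm : Monotone fun k : ℕ => f '' (D ∩ {x | x n ≤ k}) := by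
      intro a b hab
      apply image_mono
      rintro x ⟨h1, h2⟩
      exact ⟨h1, le_trans h2 hab⟩
    rw [hU, hm.measure_iUnion] at hD
    exact lt_iSup_iff.1 hD
  choose g hg using step
  let D : ℕ → {D : Set (ℕ → ℕ) // c < μ (f '' D)} := fun n =>
    Nat.rec ⟨univ, by simpa using hc⟩ (fun n D => ⟨D.1 ∩ {x | x n ≤ g D n}, hg D n⟩) n
  let k : ℕ → ℕ := fun n => g (D n) n
  have hD : ∀ n, (D n).1 = {x | ∀ i < n, x i ≤ k i} := by
    intro n
    induction n with
    | zero => ext x; simp [D]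
    | succ n ih =>
      have : (D (n+1)).1 = (D n).1 ∩ {x | x n ≤ k n} := rfl
      rw [this, ih]
      ext x
      simp only [mem_inter_iff, mem_ofPred_eq, Nat.lt_succ_iff_lt_or_eq]
      constructor
      · rintro ⟨h1, h2⟩ i (hi | rfl)
        · exact h1 i hi
        · exact h2
      · intro h
        exact ⟨fun i hi => h i (Or.inl hi), h n (Or.inr rfl)⟩
  have hKc : IsCompact {x : ℕ → ℕ | ∀ i, x i ≤ k i} := by
    have : {x : ℕ → ℕ | ∀ i, x i ≤ k i} = Set.univ.pi (fun i => Set.Iic (k i)) := by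
      ext x; simp [Pi.le_def]
    rw [this]
    exact isCompact_univ_pi fun i => (Set.finite_Iic (k i)).isCompact
  refine ⟨f '' {x | ∀ i, x i ≤ k i}, image_subset_range _ _, hKc.image hf, ?_⟩
  let := TopologicalSpace.upgradeIsCompletelyMetrizable α
  rw [Set.measure_eq_iInf_isOpen]
  refine le_iInf fun U => le_iInf fun hU => le_iInf fun hUo => ?_
  obtain ⟨n, hn⟩ := exists_cyl_subset k (f ⁻¹' U) (hUo.preimage hf) (image_subset_iff.1 hU)
  rw [← hD n] at hn
  exact (D n).2.le.trans (measure_mono (image_subset_iff.2 hn))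

lemma analytic_nullMeasurable {α : Type*} [TopologicalSpace α] [PolishSpace α]
    [MeasurableSpace α] [BorelSpace α] (μ : Measure α) [IsFiniteMeasure μ] (s : Set α)
    (hs : AnalyticSet s) : NullMeasurableSet s μ := by
  rw [AnalyticSet] at hs
  rcases hs with rfl | ⟨f, hf, rfl⟩
  · exact MeasurableSet.empty.nullMeasurableSet
  rcases eq_or_ne (μ (range f)) 0 with h0 | h0
  · exact NullMeasurableSet.of_null h0
  obtain ⟨u, -, hu, hlim⟩ := exists_seq_strictMono_tendsto' (pos_iff_ne_zero.2 h0)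
  choose K hKs hKc hK using fun n => analytic_inner μ f hf (u n) (hu n).2
  have ht : MeasurableSet (⋃ n, K n) := MeasurableSet.iUnion fun n => (hKc n).isClosed.measurableSet
  have hle : μ (range f) ≤ μ (⋃ n, K n) :=
    le_of_tendsto' hlim fun n => (hK n).trans (measure_mono (subset_iUnion K n))
  exact ht.nullMeasurableSet.congr
    (ae_eq_of_subset_of_measure_ge (iUnion_subset hKs) hle ht.nullMeasurableSet (measure_ne_top _ _))

/-- Measurable projection theorem. -/
lemma measurableSet_proj {Ω W : Type*} [MeasurableSpace Ω]
    [MeasurableSpace.CountablyGenerated Ω] [TopologicalSpace W] [PolishSpace W]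
    [MeasurableSpace W] [BorelSpace W] (P : Measure Ω) [IsFiniteMeasure P] (hP : P.IsComplete)
    (A : Set (Ω × W)) (hA : MeasurableSet A) : MeasurableSet (Prod.fst '' A) := by
  have hpb : PolishSpace (ℕ → Bool) :=
    @PolishSpace.mk _ _ inferInstance inferInstance
  let g := MeasurableSpace.mapNatBool Ω
  have hg : Measurable g := MeasurableSpace.measurable_mapNatBool Ω
  have hcomap : (inferInstance : MeasurableSpace Ω) = MeasurableSpace.comap g inferInstance := by
    apply le_antisymm _ hg.comap_le
    refine (MeasurableSpace.generateFrom_natGeneratingSequence Ω).symm.le.trans ?_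
    apply MeasurableSpace.generateFrom_le
    rintro _ ⟨n, rfl⟩
    refine ⟨{x | x n = true}, measurableSet_eq_fun (measurable_pi_apply n) measurable_const, ?_⟩
    ext ω
    simp [g, MeasurableSpace.mapNatBool]
  have hcomap2 : (inferInstance : MeasurableSpace (Ω × W)) =
      MeasurableSpace.comap (Prod.map g id) inferInstance := by
    show MeasurableSpace.comap _ _ ⊔ MeasurableSpace.comap _ _ =
      MeasurableSpace.comap _ (MeasurableSpace.comap _ _ ⊔ MeasurableSpace.comap _ _)
    rw [MeasurableSpace.comap_sup, MeasurableSpace.comap_comp, MeasurableSpace.comap_comp]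
    congr 1
    refine (congrArg _ hcomap).trans ?_
    rw [MeasurableSpace.comap_comp]
    rfl
  have hA' : MeasurableSet[MeasurableSpace.comap (Prod.map g (id : W → W)) inferInstance] A := by
    rw [← hcomap2]; exact hA
  obtain ⟨B, hB, rfl⟩ := hA'
  have : Prod.fst '' (Prod.map g (id : W → W) ⁻¹' B) = g ⁻¹' (Prod.fst '' B) := by
    ext ω
    constructor
    · rintro ⟨⟨a, w⟩, h, rfl⟩
      exact ⟨(g a, w), h, rfl⟩
    · rintro ⟨⟨a, w⟩, h, h2⟩
      refine ⟨(ω, w), ?_, rfl⟩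
      simp only at h2
      subst h2
      exact h
  rw [this]
  have han : AnalyticSet (Prod.fst '' B) :=
    hB.analyticSet.image_of_continuous continuous_fst
  have := (analytic_nullMeasurable (P.map g) _ han).preimage (f := g) (μa := P)
    ⟨hg, Measure.AbsolutelyContinuous.rfl⟩
  exact this.measurable_of_complete


lemma negMulLog_sum_le {ι : Type*} (s : Finset ι) (p : ι → ℝ) (hp : ∀ i ∈ s, 0 ≤ p i) :
    Real.negMulLog (∑ i ∈ s, p i) ≤ ∑ i ∈ s, Real.negMulLog (p i) := by
  have h : Real.negMulLog (∑ i ∈ s, p i) = ∑ i ∈ s, -(p i * Real.log (∑ j ∈ s, p j)) := by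
    rw [Real.negMulLog_eq_neg, Finset.sum_neg_distrib, ← Finset.sum_mul]
  rw [h]
  refine Finset.sum_le_sum fun i hi => ?_
  rw [Real.negMulLog_eq_neg]
  rcases (hp i hi).eq_or_lt with h0 | h0
  · simp [← h0]
  · have : Real.log (p i) ≤ Real.log (∑ j ∈ s, p j) :=
      Real.log_le_log h0 (Finset.single_le_sum hp hi)
    have := mul_le_mul_of_nonneg_left this h0.le
    simpa using this

open Classical in
lemma sum_negMulLog_le {ι : Type*} (s : Finset ι) (p : ι → ℝ) (hp : ∀ i ∈ s, 0 ≤ p i)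
    (N : ℕ) (hN : 1 ≤ N) (hc : (s.filter fun i => p i ≠ 0).card ≤ N) :
    ∑ i ∈ s, Real.negMulLog (p i) ≤
      Real.negMulLog (∑ i ∈ s, p i) + (∑ i ∈ s, p i) * Real.log N := by
  set x := ∑ i ∈ s, p i with hx
  have hx0 : 0 ≤ x := Finset.sum_nonneg hp
  have hN0 : (0 : ℝ) < N := by exact_mod_cast hN
  have key : ∀ i ∈ s, Real.negMulLog (p i) + p i * Real.log x - p i * Real.log N ≤
      (if p i ≠ 0 then x / N else 0) - p i := by
    intro i hi
    rcases (hp i hi).eq_or_lt with h0 | h0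
    · simp [← h0]
    · have hxp : 0 < x := lt_of_lt_of_le h0 (Finset.single_le_sum hp hi)
      rw [if_pos h0.ne']
      have h1 := Real.log_le_sub_one_of_pos (show 0 < x / (N * p i) by positivity)
      rw [Real.log_div hxp.ne' (by positivity), Real.log_mul hN0.ne' h0.ne'] at h1
      have h2 := mul_le_mul_of_nonneg_left h1 h0.le
      have h3 : p i * (x / (N * p i) - 1) = x / N - p i := by field_simp
      rw [h3] at h2
      rw [Real.negMulLog_eq_neg]
      linarith
  have hs := Finset.sum_le_sum key
  rw [Finset.sum_sub_distrib, Finset.sum_add_distrib, Finset.sum_sub_distrib, ← Finset.sum_mul,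
    ← Finset.sum_mul, ← Finset.sum_filter, Finset.sum_const, nsmul_eq_mul, ← hx] at hs
  have h4 : ((s.filter fun i => p i ≠ 0).card : ℝ) * (x / N) ≤ x := by
    have : ((s.filter fun i => p i ≠ 0).card : ℝ) ≤ N := by exact_mod_cast hc
    calc _ ≤ (N : ℝ) * (x / N) := by gcongr
      _ = x := by field_simp
  have h5 : Real.negMulLog x = -(x * Real.log x) := by rw [Real.negMulLog_eq_neg]
  linarith

open Classical in
lemma finite_ineq {ι κ : Type*} (R : Finset ι) (Q : Finset κ) (p : κ → ι → ℝ)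
    (hp : ∀ q ∈ Q, ∀ r ∈ R, 0 ≤ p q r) (N : ℕ) (hN : ∀ q ∈ Q, 1 ≤ N)
    (hc : ∀ q ∈ Q, (R.filter fun r => p q r ≠ 0).card ≤ N)
    (h1 : ∑ q ∈ Q, ∑ r ∈ R, p q r ≤ 1) :
    ∑ r ∈ R, Real.negMulLog (∑ q ∈ Q, p q r) ≤
      ∑ q ∈ Q, Real.negMulLog (∑ r ∈ R, p q r) + Real.log N := by
  calc _ ≤ ∑ r ∈ R, ∑ q ∈ Q, Real.negMulLog (p q r) :=
        Finset.sum_le_sum fun r hr => negMulLog_sum_le _ _ fun q hq => hp q hq r hr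
    _ = ∑ q ∈ Q, ∑ r ∈ R, Real.negMulLog (p q r) := Finset.sum_comm
    _ ≤ ∑ q ∈ Q, (Real.negMulLog (∑ r ∈ R, p q r) + (∑ r ∈ R, p q r) * Real.log N) :=
        Finset.sum_le_sum fun q hq => sum_negMulLog_le _ _ (hp q hq) N (hN q hq) (hc q hq)
    _ = ∑ q ∈ Q, Real.negMulLog (∑ r ∈ R, p q r) +
          (∑ q ∈ Q, ∑ r ∈ R, p q r) * Real.log N := by
        rw [Finset.sum_add_distrib, Finset.sum_mul]
    _ ≤ _ := by
        have := mul_le_mul_of_nonneg_right h1 (Real.log_natCast_nonneg N)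
        linarith

open Classical in
lemma coverNum_eq (q : Set (Ω × W)) (R : Finset (Set (Ω × W)))
    (hR : (R : Set (Set (Ω × W))).PairwiseDisjoint id) (hq : q ⊆ ⋃₀ (R : Set (Set (Ω × W))))
    (ω : Ω) : coverNum q (R : Set (Set (Ω × W))) ω =
      max 1 (R.filter fun r => ω ∈ Prod.fst '' (q ∩ r)).card := by
  unfold coverNum
  congr 1
  set S := {n : ℕ | ∃ F : Finset (Set (Ω × W)), (F : Set (Set (Ω × W))) ⊆ R ∧ F.card = n ∧
    fib q ω ⊆ ⋃ u ∈ F, fib u ω} with hS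
  have hmem : (R.filter fun r => ω ∈ Prod.fst '' (q ∩ r)).card ∈ S := by
    refine ⟨_, Finset.coe_subset.2 (Finset.filter_subset _ _), rfl, ?_⟩
    intro w hw
    obtain ⟨r, hr, hwr⟩ := hq hw
    simp only [mem_iUnion]
    refine ⟨r, ?_, hwr⟩
    rw [Finset.mem_filter]
    exact ⟨hr, (ω, w), ⟨hw, hwr⟩, rfl⟩
  apply le_antisymm (Nat.sInf_le hmem)
  obtain ⟨F, hF, hcard, hcov⟩ := Nat.sInf_mem ⟨_, hmem⟩
  rw [← hcard]
  refine Finset.card_le_card ?_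
  intro r hr
  rw [Finset.mem_filter] at hr
  obtain ⟨hrR, ⟨a, w⟩, ⟨hzq, hzr⟩, rfl⟩ := hr
  have := hcov hzq
  simp only [mem_iUnion] at this
  obtain ⟨u, hu, hw⟩ := this
  have : r = u := by
    by_contra hne
    exact Set.disjoint_left.1 (hR hrR (hF hu) hne) hzr hw
  rw [this]; exact hu

lemma relCoverNum_eq (R : Set (Set (Ω × W))) (Q : Finset (Set (Ω × W))) (ω : Ω) :
    relCoverNum R (Q : Set (Set (Ω × W))) ω = Q.sup fun q => coverNum q R ω := by
  unfold relCoverNum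
  have hin : ∀ q, (⨆ (_ : q ∈ (Q : Set (Set (Ω × W)))), coverNum q R ω) ≤
      Q.sup fun q => coverNum q R ω := fun q => ciSup_le' fun hq =>
        Finset.le_sup (f := fun q => coverNum q R ω) (Finset.mem_coe.1 hq)
  apply le_antisymm
  · exact ciSup_le' hin
  · refine Finset.sup_le fun q hq => ?_
    refine le_ciSup_of_le ⟨_, by rintro _ ⟨q, rfl⟩; exact hin q⟩ q ?_
    exact le_ciSup_of_le (Set.finite_range _).bddAbove (Finset.mem_coe.2 hq) le_rfl

lemma measurable_relCoverNum [MeasurableSpace Ω] (R Q : Finset (Set (Ω × W)))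
    (hR : (R : Set (Set (Ω × W))).PairwiseDisjoint id)
    (hq : ∀ q ∈ Q, q ⊆ ⋃₀ (R : Set (Set (Ω × W))))
    (hm : ∀ q ∈ Q, ∀ r ∈ R, MeasurableSet (Prod.fst '' (q ∩ r))) :
    Measurable (relCoverNum (R : Set (Set (Ω × W))) (Q : Set (Set (Ω × W)))) := by
  classical
  have h1 : ∀ q ∈ Q, Measurable (coverNum q (R : Set (Set (Ω × W)))) := by
    intro q hqQ
    have : coverNum q (R : Set (Set (Ω × W))) = fun ω => max 1
        (∑ r ∈ R, if ω ∈ Prod.fst '' (q ∩ r) then 1 else 0) := by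
      ext ω
      rw [coverNum_eq q R hR (hq q hqQ), Finset.card_filter]
    rw [this]
    refine measurable_const.max (Finset.measurable_sum _ fun r hr => ?_)
    exact Measurable.ite (hm q hqQ r hr) measurable_const measurable_const
  have : relCoverNum (R : Set (Set (Ω × W))) (Q : Set (Set (Ω × W))) =
      fun ω => Q.sup fun q => coverNum q (R : Set (Set (Ω × W))) ω := by
    ext ω; exact relCoverNum_eq _ _ _
  rw [this]
  clear this hq hm
  induction Q using Finset.induction_on with
  | empty => simp
  | insert a s ha ih =>
    simp only [Finset.sup_insert]
    exact (h1 a (Finset.mem_insert_self _ _)).sup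
      (ih fun q hq => h1 q (Finset.mem_insert_of_mem hq))

lemma relCoverNum_le [MeasurableSpace Ω] (R Q : Finset (Set (Ω × W)))
    (hR : (R : Set (Set (Ω × W))).PairwiseDisjoint id)
    (hq : ∀ q ∈ Q, q ⊆ ⋃₀ (R : Set (Set (Ω × W)))) (ω : Ω) :
    relCoverNum (R : Set (Set (Ω × W))) (Q : Set (Set (Ω × W))) ω ≤ max 1 R.card := by
  classical
  rw [relCoverNum_eq]
  refine Finset.sup_le fun q hqQ => ?_
  rw [coverNum_eq q R hR (hq q hqQ)]
  exact max_le_max le_rfl (Finset.card_filter_le _ _)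

lemma sum_indicator_inter {Z : Type*} (Q : Finset (Set Z))
    (hQ : (Q : Set (Set Z)).PairwiseDisjoint id) (A : Set Z) (hA : A ⊆ ⋃₀ (Q : Set (Set Z))) :
    ∑ q ∈ Q, (q ∩ A).indicator (fun _ => (1 : ℝ)) = A.indicator fun _ => 1 := by
  ext z
  rw [Finset.sum_apply]
  by_cases hz : z ∈ A
  · obtain ⟨q, hq, hzq⟩ := hA hz
    rw [Finset.sum_eq_single_of_mem q hq]
    · simp [hz, hzq]
    · intro b hb hne
      have : z ∉ b := fun h => Set.disjoint_left.1 (hQ hb hq hne) h hzq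
      simp [this]
  · simp [hz]

section CE
variable {Z : Type*} {m : MeasurableSpace Z} [mZ : MeasurableSpace Z] (μ : Measure Z)
  [IsProbabilityMeasure μ]

lemma integrable_ind {A : Set Z} (hA : MeasurableSet A) :
    Integrable (A.indicator (fun _ => (1 : ℝ))) μ :=
  (integrable_const 1).indicator hA

lemma ce_nonneg (A : Set Z) :
    ∀ᵐ z ∂μ, 0 ≤ (μ[A.indicator (fun _ => (1 : ℝ)) | m]) z :=
  condExp_nonneg (Eventually.of_forall fun z => Set.indicator_nonneg (fun _ _ => zero_le_one) z)

lemma ce_le_one (hm : m ≤ mZ) {A : Set Z} (hA : MeasurableSet A) :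
    ∀ᵐ z ∂μ, (μ[A.indicator (fun _ => (1 : ℝ)) | m]) z ≤ 1 := by
  have := condExp_mono (m := m) (integrable_ind μ hA) (integrable_const (1 : ℝ))
    (Eventually.of_forall fun z => Set.indicator_le_self' (fun _ _ => zero_le_one) z)
  rw [condExp_const hm] at this
  exact this

lemma ce_sum (Q : Finset (Set Z))
    (hQ : (Q : Set (Set Z)).PairwiseDisjoint id) (hQm : ∀ q ∈ Q, MeasurableSet q) (A : Set Z)
    (hAm : MeasurableSet A) (hA : A ⊆ ⋃₀ (Q : Set (Set Z))) :
    ∀ᵐ z ∂μ, (μ[A.indicator (fun _ => (1 : ℝ)) | m]) z =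
      ∑ q ∈ Q, (μ[(q ∩ A).indicator (fun _ => (1 : ℝ)) | m]) z := by
  have := condExp_finsetSum (μ := μ) (s := Q)
    (f := fun q => (q ∩ A).indicator (fun _ => (1 : ℝ)))
    (fun q hq => integrable_ind μ ((hQm q hq).inter hAm)) m
  rw [sum_indicator_inter Q hQ A hA] at this
  filter_upwards [this] with z hz
  rw [hz, Finset.sum_apply]

lemma ce_zero (A B : Set Z) (hA : MeasurableSet A)
    (hB : MeasurableSet[m] B) (hAB : A ⊆ B) :
    ∀ᵐ z ∂μ, z ∉ B → (μ[A.indicator (fun _ => (1 : ℝ)) | m]) z = 0 := by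
  have := condExp_indicator (integrable_ind μ hA) hB
  rw [Set.indicator_indicator, Set.inter_eq_right.2 hAB] at this
  filter_upwards [this] with z hz hzB
  rw [hz, Set.indicator_of_notMem hzB]

lemma ce_integrable (hm : m ≤ mZ) {A : Set Z} (hA : MeasurableSet A) :
    Integrable (fun z => Real.negMulLog ((μ[A.indicator (fun _ => (1 : ℝ)) | m]) z)) μ := by
  refine Integrable.of_bound (C := 1) ?_ ?_
  · exact Real.continuous_negMulLog.comp_aestronglyMeasurable
      (stronglyMeasurable_condExp.mono hm).aestronglyMeasurable
  · filter_upwards [ce_nonneg (m := m) μ A, ce_le_one μ hm hA] with z h0 h1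
    rw [Real.norm_of_nonneg (Real.negMulLog_nonneg h0 h1)]
    have := Real.negMulLog_le_one_sub_self h0
    linarith

lemma partCondEntropy_eq (hm : m ≤ mZ) (R : Finset (Set Z)) (hR : ∀ r ∈ R, MeasurableSet r) :
    partCondEntropy m μ (R : Set (Set Z)) = ENNReal.ofReal
      (∫ z, ∑ r ∈ R, Real.negMulLog ((μ[r.indicator (fun _ => (1 : ℝ)) | m]) z) ∂μ) := by
  unfold partCondEntropy
  rw [integral_finsetSum _ fun r hr => ce_integrable μ hm (hR r hr)]
  rw [ENNReal.ofReal_sum_of_nonneg]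
  · exact Finset.tsum_subtype R fun r => ENNReal.ofReal
      (∫ z, Real.negMulLog ((μ[r.indicator (fun _ => (1 : ℝ)) | m]) z) ∂μ)
  · intro r hr
    refine integral_nonneg_of_ae ?_
    filter_upwards [ce_nonneg (m := m) μ r, ce_le_one μ hm (hR r hr)] with z h0 h1
    exact Real.negMulLog_nonneg h0 h1

end CE

/-- `H_μ(R|D_H) ≤ H_μ(Q|D_H) + ∫ log N(R|Q)(ω) dP(ω)` for finite
measurable partitions `R`, `Q` of `H`. -/
theorem condEntropy_le_condEntropy_add_integral_log
    {Ω X Y : Type*} [MeasurableSpace Ω] [MeasurableSpace.CountablyGenerated Ω]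
    [MetricSpace X] [CompactSpace X] [MeasurableSpace X] [BorelSpace X]
    [MetricSpace Y] [CompactSpace Y] [MeasurableSpace Y] [BorelSpace Y]
    (P : Measure Ω) [IsProbabilityMeasure P] (hP : P.IsComplete)
    (ϑ : Ω → Ω) (E : Set (Ω × X)) (hE : MeasurableSet E) (hEc : ∀ ω, IsCompact (fib E ω))
    (G : Set (Ω × Y)) (hG : MeasurableSet G) (hGc : ∀ ω, IsCompact (fib G ω))
    (T : Ω → X → X) (hT : IsBundleRDS P ϑ E T)
    (S : Ω → Y → Y) (hS : IsBundleRDS P ϑ G S) :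
    let Hset : Set (Ω × Y × X) := {p | p.2.1 ∈ fib G p.1 ∧ p.2.2 ∈ fib E p.1}
    ∀ μ : Measure (Ω × Y × X), IsProbabilityMeasure μ →
      μ.map Prod.fst = P → μ Hset = 1 →
      ∀ R Q : Set (Set (Ω × Y × X)), R.Finite → Q.Finite →
        IsCountablePartition Hset R → IsCountablePartition Hset Q →
        partCondEntropy (firstPairSigma Ω Y X) μ R ≤ partCondEntropy (firstPairSigma Ω Y X) μ Q +
          ENNReal.ofReal (∫ ω, Real.log (relCoverNum R Q ω : ℝ) ∂P) := by
  intro Hset μ hμ hmap _ R Q hRf hQf hR hQ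
  classical
  obtain ⟨R, rfl⟩ := hRf.exists_finset_coe
  obtain ⟨Q, rfl⟩ := hQf.exists_finset_coe
  obtain ⟨-, hRm, hRH, hRd, hRU⟩ := hR
  obtain ⟨-, hQm, hQH, hQd, hQU⟩ := hQ
  have hm : firstPairSigma Ω Y X ≤ (inferInstance : MeasurableSpace (Ω × Y × X)) := by
    refine Measurable.comap_le ?_
    exact measurable_fst.prodMk (measurable_fst.comp measurable_snd)
  have hproj : ∀ q ∈ Q, ∀ r ∈ R, MeasurableSet (Prod.fst '' (q ∩ r)) := fun q hq r hr =>
    measurableSet_proj P hP _ ((hQm q hq).inter (hRm r hr))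
  have hqR : ∀ q ∈ Q, q ⊆ ⋃₀ (R : Set (Set (Ω × Y × X))) := fun q hq => by
    rw [hRU]; exact hQH q hq
  have hrQ : ∀ r ∈ R, r ⊆ ⋃₀ (Q : Set (Set (Ω × Y × X))) := fun r hr => by
    rw [hQU]; exact hRH r hr
  have hHm : MeasurableSet Hset := by
    rw [← hQU]; exact MeasurableSet.sUnion Q.countable_toSet hQm
  set N := relCoverNum (R : Set (Set (Ω × Y × X))) (Q : Set (Set (Ω × Y × X))) with hN
  have hNm : Measurable N := measurable_relCoverNum R Q hRd hqR hproj
  have hlogm : Measurable fun ω => Real.log (N ω : ℝ) :=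
    Real.measurable_log.comp (measurable_from_nat.comp hNm)
  have hfst : Measurable fun z : Ω × Y × X => z.1 := measurable_fst
  have hlogi : Integrable (fun z : Ω × Y × X => Real.log (N z.1 : ℝ)) μ := by
    refine Integrable.of_bound (C := Real.log (max 1 R.card : ℕ))
      (hlogm.comp hfst).aestronglyMeasurable (Eventually.of_forall fun z => ?_)
    rw [Real.norm_of_nonneg (Real.log_natCast_nonneg _)]
    rcases Nat.eq_zero_or_pos (N z.1) with h0 | h0
    · rw [h0]; simpa using Real.log_natCast_nonneg (max 1 R.card)
    · refine Real.log_le_log (by exact_mod_cast h0) ?_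
      exact_mod_cast relCoverNum_le R Q hRd hqR z.1
  have hint : ∫ ω, Real.log (N ω : ℝ) ∂P = ∫ z, Real.log (N z.1 : ℝ) ∂μ := by
    rw [← hmap]
    exact integral_map hfst.aemeasurable hlogm.aestronglyMeasurable
  have hRi : Integrable (fun z => ∑ r ∈ R,
      Real.negMulLog ((μ[r.indicator (fun _ => (1 : ℝ)) | firstPairSigma Ω Y X]) z)) μ :=
    integrable_finsetSum _ fun r hr => ce_integrable μ hm (hRm r hr)
  have hQi : Integrable (fun z => ∑ q ∈ Q,
      Real.negMulLog ((μ[q.indicator (fun _ => (1 : ℝ)) | firstPairSigma Ω Y X]) z)) μ :=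
    integrable_finsetSum _ fun q hq => ce_integrable μ hm (hQm q hq)
  have hae : ∀ᵐ z ∂μ, ∑ r ∈ R, Real.negMulLog ((μ[r.indicator (fun _ => (1 : ℝ)) | firstPairSigma Ω Y X]) z) ≤
      ∑ q ∈ Q, Real.negMulLog ((μ[q.indicator (fun _ => (1 : ℝ)) | firstPairSigma Ω Y X]) z) +
        Real.log (N z.1 : ℝ) := by
    have a1 : ∀ᵐ z ∂μ, ∀ r ∈ R, (μ[r.indicator (fun _ => (1 : ℝ)) | firstPairSigma Ω Y X]) z =
        ∑ q ∈ Q, (μ[(q ∩ r).indicator (fun _ => (1 : ℝ)) | firstPairSigma Ω Y X]) z :=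
      (Finset.eventually_all R).2 fun r hr => ce_sum (m := firstPairSigma Ω Y X) μ Q hQd hQm r (hRm r hr) (hrQ r hr)
    have a2 : ∀ᵐ z ∂μ, ∀ q ∈ Q, (μ[q.indicator (fun _ => (1 : ℝ)) | firstPairSigma Ω Y X]) z =
        ∑ r ∈ R, (μ[(q ∩ r).indicator (fun _ => (1 : ℝ)) | firstPairSigma Ω Y X]) z := by
      refine (Finset.eventually_all Q).2 fun q hq => ?_
      have := ce_sum (m := firstPairSigma Ω Y X) μ R hRd hRm q (hQm q hq) (hqR q hq)
      simpa only [inter_comm q] using this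
    have a3 : ∀ᵐ z ∂μ, ∀ q ∈ Q, ∀ r ∈ R,
        0 ≤ (μ[(q ∩ r).indicator (fun _ => (1 : ℝ)) | firstPairSigma Ω Y X]) z :=
      (Finset.eventually_all Q).2 fun q hq => (Finset.eventually_all R).2 fun r hr =>
        ce_nonneg (m := firstPairSigma Ω Y X) μ _
    have a4 : ∀ᵐ z ∂μ, ∀ q ∈ Q, ∀ r ∈ R, z ∉ Prod.fst ⁻¹' (Prod.fst '' (q ∩ r)) →
        (μ[(q ∩ r).indicator (fun _ => (1 : ℝ)) | firstPairSigma Ω Y X]) z = 0 := by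
      refine (Finset.eventually_all Q).2 fun q hq => (Finset.eventually_all R).2 fun r hr =>
        ce_zero (m := firstPairSigma Ω Y X) μ _ _ ((hQm q hq).inter (hRm r hr)) ?_ (subset_preimage_image _ _)
      exact ⟨Prod.fst ⁻¹' (Prod.fst '' (q ∩ r)), measurable_fst (hproj q hq r hr), rfl⟩
    have a5 := ce_sum (m := firstPairSigma Ω Y X) μ Q hQd hQm Hset hHm hQU.symm.subset
    have a6 := ce_le_one μ hm hHm
    filter_upwards [a1, a2, a3, a4, a5, a6] with z h1 h2 h3 h4 h5 h6
    rw [Finset.sum_congr rfl fun r hr => congrArg Real.negMulLog (h1 r hr),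
      Finset.sum_congr rfl fun q hq => congrArg Real.negMulLog (h2 q hq)]
    have hcov : ∀ q ∈ Q, coverNum q (R : Set (Set (Ω × Y × X))) z.1 ≤ N z.1 := by
      intro q hq
      rw [hN, relCoverNum_eq]
      exact Finset.le_sup (f := fun q => coverNum q (R : Set (Set (Ω × Y × X))) z.1) hq
    refine finite_ineq R Q
      (fun q r => (μ[(q ∩ r).indicator (fun _ => (1 : ℝ)) | firstPairSigma Ω Y X]) z) h3 (N z.1) ?_ ?_ ?_
    · intro q hq
      exact (le_max_left _ _).trans (hcov q hq)
    · intro q hq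
      refine le_trans ?_ (hcov q hq)
      rw [coverNum_eq q R hRd (hqR q hq)]
      refine le_trans (Finset.card_le_card ?_) (le_max_right _ _)
      intro r hr
      rw [Finset.mem_filter] at hr ⊢
      refine ⟨hr.1, ?_⟩
      by_contra hcon
      exact hr.2 (h4 q hq r hr.1 hcon)
    · rw [← Finset.sum_congr rfl h2]
      rw [h5] at h6
      refine le_trans (le_of_eq ?_) h6
      refine Finset.sum_congr rfl fun q hq => ?_
      rw [inter_eq_left.2 (hQH q hq)]
  rw [partCondEntropy_eq μ hm R hRm, partCondEntropy_eq μ hm Q hQm, hint]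
  refine le_trans (ENNReal.ofReal_le_ofReal ?_) ENNReal.ofReal_add_le
  rw [← integral_add hQi hlogi]
  exact integral_mono_ae hRi (hQi.add hlogi) hae

end RelTail
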